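/- Let p ∈ [1, 2] and let q be its conjugate exponent (1/p + 1/q = 1). Let Z ⊂ ℝ^n be a compact convex set and let d : Z → ℝ be differentiable and 1-strongly convex with respect to ‖·‖_p on Z; let V_x(y) = d(y) − d(x) − ⟨∇d(x), y − x⟩ be the associated Bregman divergence. Let γ_1, …, γ_N > 0 and g_1, …, g_N ∈ ℝ^n. Let z_1 ∈ Z and Ω > 0 satisfy V_{z_1}(u) ≤ Ω²/2 for all u ∈ Z, and define recursively z_{k+1} = argmin_{y ∈ Z} ( V_{z_k}(y) + γ_k·⟨g_k, y⟩ ). Then for every u ∈ Z: ∑_{k=1}^N γ_k·⟨g_k, z_k − u⟩ ≤ Ω²/2 + (1/2)·∑_{k=1}^N γ_k²·‖g_k‖_q². -/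

import Mathlib

open MeasureTheory ENNReal

/-- The `ℓ_p` norm of a vector in `ℝ^n`, for real `p ∈ [1, ∞)`. -/
noncomputable def lpnorm {n : ℕ} (p : ℝ) (x : Fin n → ℝ) : ℝ :=
  (∑ i, |x i| ^ p) ^ (1 / p)

/-- The `ℓ_q` norm of a vector in `ℝ^n`, for `q ∈ [1, ∞]` (extended-real exponent). -/
noncomputable def lpnormE {n : ℕ} (q : ℝ≥0∞) (x : Fin n → ℝ) : ℝ :=
  if q = ⊤ then ⨆ i, |x i| else (∑ i, |x i| ^ q.toReal) ^ (1 / q.toReal)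

/-- The standard inner product `⟨a, b⟩ = ∑ i, a i * b i` on `ℝ^n`. -/
noncomputable def rdot {n : ℕ} (a b : Fin n → ℝ) : ℝ := ∑ i, a i * b i

/-- The continuous linear functional `v ↦ ∑ i, a i * v i` on `ℝ^n`. -/
noncomputable def toCLM {n : ℕ} (a : Fin n → ℝ) : (Fin n → ℝ) →L[ℝ] ℝ :=
  LinearMap.toContinuousLinearMap
    (∑ i, a i • (LinearMap.proj i : (Fin n → ℝ) →ₗ[ℝ] ℝ))

theorem aux_holder {n : ℕ} (p : ℝ) (hp1 : 1 ≤ p) (q : ℝ≥0∞)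
    (hpq : 1 / ENNReal.ofReal p + 1 / q = 1) (a b : Fin n → ℝ) :
    rdot a b ≤ lpnormE q a * lpnorm p b := by
  have hp0 : 0 < p := by linarith
  by_cases hq : q = ⊤
  · subst hq
    have hp : p = 1 := by
      simp at hpq
      exact hpq
    subst hp
    simp only [lpnormE, lpnorm, rdot, if_true, Real.rpow_one, div_one]
    rw [Finset.mul_sum]
    refine Finset.sum_le_sum fun i _ => ?_
    calc a i * b i ≤ |a i * b i| := le_abs_self _
      _ = |a i| * |b i| := abs_mul _ _
      _ ≤ _ := mul_le_mul_of_nonneg_right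
        (le_ciSup (f := fun i => |a i|) (Set.finite_range _).bddAbove i) (abs_nonneg _)
  · have hq0 : q ≠ 0 := by
      rintro rfl
      simp at hpq
    have hqr : 0 < q.toReal := ENNReal.toReal_pos hq0 hq
    have h : p⁻¹ + q.toReal⁻¹ = 1 := by
      have := congrArg ENNReal.toReal hpq
      rw [ENNReal.toReal_add (by simp [hp0]) (by simp [hq0])] at this
      simpa [ENNReal.toReal_ofReal hp0.le] using this
    have hc : q.toReal.HolderConjugate p := by
      rw [Real.holderConjugate_iff]
      constructor
      · have h1 : 0 < p⁻¹ := by positivity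
        have h2 : q.toReal⁻¹ < 1 := by linarith
        exact (inv_lt_one₀ hqr).1 h2
      · linarith
    simp only [lpnormE, lpnorm, rdot, if_neg hq]
    exact Real.inner_le_Lp_mul_Lq Finset.univ a b hc

theorem aux_toCLM {n : ℕ} (a v : Fin n → ℝ) : toCLM a v = rdot a v := by
  simp [toCLM, rdot]

theorem aux_sub {n : ℕ} (a v w : Fin n → ℝ) : rdot a (v - w) = rdot a v - rdot a w := by
  simp [rdot, mul_sub]

theorem aux_norm {n : ℕ} (p : ℝ) (v w : Fin n → ℝ) : lpnorm p (v - w) = lpnorm p (w - v) := by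
  simp [lpnorm, abs_sub_comm]

/-- mirror-descent telescoping bound: `p ∈ [1, 2]` with conjugate `q`,
`Z ⊂ ℝ^n` compact convex, `d` differentiable (gradient `gd`) and 1-strongly convex w.r.t.
`‖·‖_p` on `Z` with Bregman divergence `V`, steps `γ_k > 0`, vectors `g_k`, `z_1 ∈ Z` with
`V_{z_1}(u) ≤ Ω²/2` on `Z`, and `z_{k+1} = argmin_{y ∈ Z}(V_{z_k}(y) + γ_k⟨g_k, y⟩)`. Then
`∑_{k=1}^N γ_k⟨g_k, z_k − u⟩ ≤ Ω²/2 + (1/2)∑_{k=1}^N γ_k²‖g_k‖_q²` for all `u ∈ Z`. -/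
theorem statement5 (n N : ℕ) (p : ℝ) (hp1 : 1 ≤ p) (hp2 : p ≤ 2)
    (q : ℝ≥0∞) (hpq : 1 / ENNReal.ofReal p + 1 / q = 1)
    (Z : Set (Fin n → ℝ)) (hZc : IsCompact Z) (hZconv : Convex ℝ Z)
    (d : (Fin n → ℝ) → ℝ) (gd : (Fin n → ℝ) → Fin n → ℝ)
    (hdiff : ∀ x ∈ Z, HasFDerivWithinAt d (toCLM (gd x)) Z x)
    (hstrong : ∀ x ∈ Z, ∀ y ∈ Z,
      d x + rdot (gd x) (y - x) + (1 / 2) * (lpnorm p (y - x)) ^ 2 ≤ d y)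
    (V : (Fin n → ℝ) → (Fin n → ℝ) → ℝ)
    (hV : ∀ x y, V x y = d y - d x - rdot (gd x) (y - x))
    (γ : ℕ → ℝ) (hγ : ∀ k, 0 < γ k)
    (g : ℕ → Fin n → ℝ)
    (z : ℕ → Fin n → ℝ) (hz1 : z 1 ∈ Z)
    (Ωd : ℝ) (hΩd : ∀ u ∈ Z, V (z 1) u ≤ Ωd ^ 2 / 2) (hΩpos : 0 < Ωd)
    (hrec : ∀ k, 1 ≤ k → k ≤ N → z (k + 1) ∈ Z ∧
      IsMinOn (fun y => V (z k) y + γ k * rdot (g k) y) Z (z (k + 1))) :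
    ∀ u ∈ Z,
      ∑ k ∈ Finset.Icc 1 N, γ k * rdot (g k) (z k - u) ≤
        Ωd ^ 2 / 2 + (1 / 2) * ∑ k ∈ Finset.Icc 1 N, (γ k) ^ 2 * (lpnormE q (g k)) ^ 2 := by
  have hstep : ∀ k ∈ Finset.Icc 1 N, z k ∈ Z → z (k + 1) ∈ Z → ∀ u ∈ Z,
      γ k * rdot (g k) (z k - u) ≤ V (z k) u - V (z (k + 1)) u
        + (1 / 2) * ((γ k) ^ 2 * (lpnormE q (g k)) ^ 2) := by
    intro k hk hzk hw u hu
    rw [Finset.mem_Icc] at hk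
    obtain ⟨-, hmin⟩ := hrec k hk.1 hk.2
    have hder : HasFDerivWithinAt (fun y => V (z k) y + γ k * rdot (g k) y)
        (toCLM (gd (z (k + 1))) - toCLM (gd (z k)) + γ k • toCLM (g k)) Z (z (k + 1)) := by
      have h1 := (((hdiff _ hw).sub (toCLM (gd (z k))).hasFDerivWithinAt).add
        ((toCLM (g k)).hasFDerivWithinAt.const_smul (γ k))).add_const
          (rdot (gd (z k)) (z k) - d (z k))
      refine HasFDerivWithinAt.congr_of_eventuallyEq h1 (Filter.EventuallyEq.of_eq (funext fun y => ?_)) ?_ <;>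
      · simp only [hV, aux_sub, Pi.add_apply, Pi.sub_apply, Pi.smul_apply, aux_toCLM, smul_eq_mul]
        ring
    have hopt := hmin.localize.hasFDerivWithinAt_nonneg hder
      (sub_mem_posTangentConeAt_of_segment_subset (hZconv.segment_subset hw hu))
    simp only [add_apply, sub_apply, smul_apply, ContinuousLinearMap.add_apply,
      ContinuousLinearMap.sub_apply, ContinuousLinearMap.smul_apply, aux_toCLM,
      smul_eq_mul, aux_sub] at hopt
    have hh := aux_holder p hp1 q hpq (g k) (z k - z (k + 1))
    have hs := hstrong _ hzk _ hw
    rw [aux_norm] at hs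
    have hm := mul_le_mul_of_nonneg_left hh (hγ k).le
    have hsq := sq_nonneg (γ k * lpnormE q (g k) - lpnorm p (z k - z (k + 1)))
    simp only [hV, aux_sub] at *
    nlinarith
  have hmem : ∀ k, 1 ≤ k → k ≤ N + 1 → z k ∈ Z := by
    intro k h1 h2
    obtain rfl | h := Nat.eq_or_lt_of_le h1
    · exact hz1
    · obtain ⟨j, rfl⟩ : ∃ j, k = j + 1 := ⟨k - 1, by omega⟩
      exact (hrec j (by omega) (by omega)).1
  intro u hu
  have htel : ∀ M, M ≤ N → ∑ k ∈ Finset.Icc 1 M, γ k * rdot (g k) (z k - u) ≤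
      V (z 1) u - V (z (M + 1)) u
        + (1 / 2) * ∑ k ∈ Finset.Icc 1 M, (γ k) ^ 2 * (lpnormE q (g k)) ^ 2 := by
    intro M
    induction M with
    | zero => intro _; simp
    | succ M ih =>
      intro hM
      have h1 := ih (by omega)
      have h2 := hstep (M + 1) (Finset.mem_Icc.2 ⟨by omega, hM⟩) (hmem _ (by omega) (by omega))
        (hmem _ (by omega) (by omega)) u hu
      rw [Finset.sum_Icc_succ_top (by omega), Finset.sum_Icc_succ_top (by omega)]
      linarith
  have h1 := htel N le_rfl
  have h2 := hΩd u hu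
  have h3 : 0 ≤ V (z (N + 1)) u := by
    have := hstrong _ (hmem (N + 1) (by omega) le_rfl) u hu
    rw [hV]
    nlinarith [sq_nonneg (lpnorm p (u - z (N + 1)))]
  linarith
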